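/- Let μ > 0, let F : ℝ → ℝ³ be a perturbing acceleration, and let r : ℝ → ℝ³ be twice differentiable on an open interval I with r(t) ≠ 0 and H(t) = r(t) × r'(t) ≠ 0, satisfying the perturbed equation of motion r''(t) = −(μ/‖r(t)‖³) r(t) + F(t) on I. Let e_T(t) = (H(t) × r(t))/(‖H(t)‖·‖r(t)‖) be the unit transverse vector. Then the norm of the angular momentum satisfies (d/dt)‖H(t)‖ = ‖r(t)‖ · ⟨F(t), e_T(t)⟩ on I (i.e. dH/dt = r T where T is the transverse component of the perturbation). -/

import Mathlib

open RealInnerProductSpace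

/-- The three-dimensional cross product on `ℝ³` with the Euclidean norm. -/
noncomputable def cross3 (a b : EuclideanSpace ℝ (Fin 3)) : EuclideanSpace ℝ (Fin 3) :=
  (WithLp.equiv 2 (Fin 3 → ℝ)).symm
    ![a 1 * b 2 - a 2 * b 1, a 2 * b 0 - a 0 * b 2, a 0 * b 1 - a 1 * b 0]

@[simp]
theorem cross3_apply_zero (a b : EuclideanSpace ℝ (Fin 3)) :
    cross3 a b 0 = a 1 * b 2 - a 2 * b 1 := rfl

@[simp]
theorem cross3_apply_one (a b : EuclideanSpace ℝ (Fin 3)) :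
    cross3 a b 1 = a 2 * b 0 - a 0 * b 2 := rfl

@[simp]
theorem cross3_apply_two (a b : EuclideanSpace ℝ (Fin 3)) :
    cross3 a b 2 = a 0 * b 1 - a 1 * b 0 := rfl

theorem cross3_self (a : EuclideanSpace ℝ (Fin 3)) : cross3 a a = 0 := by
  ext i
  fin_cases i <;> simp <;> ring

theorem cross3_smul_add_right (c : ℝ) (a b : EuclideanSpace ℝ (Fin 3)) :
    cross3 a (c • a + b) = cross3 a b := by
  ext i
  fin_cases i <;> simp <;> ring

theorem inner_cross3_right_comm (a b c : EuclideanSpace ℝ (Fin 3)) :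
    ⟪a, cross3 b c⟫ = ⟪c, cross3 a b⟫ := by
  simp only [PiLp.inner_apply, Fin.sum_univ_three, cross3_apply_zero, cross3_apply_one,
    cross3_apply_two, RCLike.inner_apply, conj_trivial]
  ring

theorem hasDerivAt_cross3 {f g : ℝ → EuclideanSpace ℝ (Fin 3)}
    {f' g' : EuclideanSpace ℝ (Fin 3)} {t : ℝ}
    (hf : HasDerivAt f f' t) (hg : HasDerivAt g g' t) :
    HasDerivAt (fun s => cross3 (f s) (g s))
      (cross3 f' (g t) + cross3 (f t) g') t := by
  have hf' := fun i => (EuclideanSpace.proj (𝕜 := ℝ) i).hasFDerivAt.comp_hasDerivAt t hf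
  have hg' := fun i => (EuclideanSpace.proj (𝕜 := ℝ) i).hasFDerivAt.comp_hasDerivAt t hg
  have h : ∀ i, HasDerivAt (fun s => cross3 (f s) (g s) i)
      ((cross3 f' (g t) + cross3 (f t) g') i) t := by
    intro i
    fin_cases i
    · refine (((hf' 1).mul (hg' 2)).sub ((hf' 2).mul (hg' 1))).congr_deriv ?_
      simp; ring
    · refine (((hf' 2).mul (hg' 0)).sub ((hf' 0).mul (hg' 2))).congr_deriv ?_
      simp; ring
    · refine (((hf' 0).mul (hg' 1)).sub ((hf' 1).mul (hg' 0))).congr_deriv ?_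
      simp; ring
  exact (PiLp.continuousLinearEquiv 2 ℝ fun _ : Fin 3 => ℝ).symm.hasFDerivAt.comp_hasDerivAt t
    (hasDerivAt_pi.mpr h)

theorem HasDerivAt.norm_of_ne_zero {E : Type*} [NormedAddCommGroup E] [InnerProductSpace ℝ E]
    {f : ℝ → E} {f' : E} {t : ℝ} (hf : HasDerivAt f f' t) (h0 : f t ≠ 0) :
    HasDerivAt (fun s => ‖f s‖) (⟪f t, f'⟫ / ‖f t‖) t := by
  have hn : ‖f t‖ ≠ 0 := norm_ne_zero_iff.mpr h0
  have h := hf.norm_sq.sqrt (pow_ne_zero 2 hn)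
  simp only [Real.sqrt_sq (norm_nonneg _)] at h
  exact h.congr_deriv (mul_div_mul_left _ _ two_ne_zero)

/-- For a solution of the perturbed two-body equation `r'' = -(μ/‖r‖³) r + F` on an
open interval `I` with nonvanishing angular momentum `H = r × r'`, the norm of the
angular momentum satisfies `(d/dt)‖H‖ = ‖r‖ ⟪F, e_T⟫` on `I`, where
`e_T = (H × r)/(‖H‖‖r‖)` is the unit transverse vector. -/
theorem angularMomentum_norm_deriv_of_perturbed
    (μ : ℝ) (hμ : 0 < μ) (F : ℝ → EuclideanSpace ℝ (Fin 3))
    (I : Set ℝ) (hI : IsOpen I) (hI' : I.OrdConnected)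
    (r : ℝ → EuclideanSpace ℝ (Fin 3))
    (hr : ∀ t ∈ I, r t ≠ 0)
    (hd1 : ∀ t ∈ I, DifferentiableAt ℝ r t)
    (hd2 : ∀ t ∈ I, DifferentiableAt ℝ (deriv r) t)
    (heq : ∀ t ∈ I, deriv (deriv r) t = (-(μ / ‖r t‖ ^ 3)) • r t + F t)
    (H eT : ℝ → EuclideanSpace ℝ (Fin 3))
    (hH : ∀ t, H t = cross3 (r t) (deriv r t))
    (hHne : ∀ t ∈ I, H t ≠ 0)
    (heT : ∀ t, eT t = (1 / (‖H t‖ * ‖r t‖)) • cross3 (H t) (r t)) :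
    ∀ t ∈ I, HasDerivAt (fun s => ‖H s‖) (‖r t‖ * ⟪F t, eT t⟫) t := by
  intro t ht
  have hrn : ‖r t‖ ≠ 0 := norm_ne_zero_iff.mpr (hr t ht)
  have hderiv : HasDerivAt H (cross3 (r t) (F t)) t := by
    rw [funext hH]
    refine (hasDerivAt_cross3 (hd1 t ht).hasDerivAt (hd2 t ht).hasDerivAt).congr_deriv ?_
    rw [cross3_self, zero_add, heq t ht, cross3_smul_add_right]
  refine (hderiv.norm_of_ne_zero (hHne t ht)).congr_deriv ?_
  rw [heT, inner_smul_right, inner_cross3_right_comm]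
  field_simp
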